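/- arXiv:2408.13258 — 2 statements merged into one kernel-verified Lean document; each statement's English description precedes it below -/
import Mathlib

section
/- Let f be a parabolic Monge form with a_{3,0} = 0 and a_{2,1} ≠ 0. Then there exist ε > 0 and a C^∞ function ψ : (−ε,ε) → ℝ such that P(t, ψ(t)) = 0 for all |t| < ε, ψ(0) = ψ'(0) = 0, and ψ''(0) = (2 a_{2,1}² − a_{4,0} k₂)/(a_{2,1} k₂). Moreover ψ is locally unique: any C^∞ function ψ̃ defined near 0 with ψ̃(0) = 0 and P(t, ψ̃(t)) = 0 for all t near 0 coincides with ψ near 0. -/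
open Real Set

noncomputable section

/-- Partial derivative in the first variable. -/
def pdu {F : Type*} [NormedAddCommGroup F] [NormedSpace ℝ F] (f : ℝ → ℝ → F) : ℝ → ℝ → F :=
  fun u w => deriv (fun t => f t w) u

/-- Partial derivative in the second variable. -/
def pdw {F : Type*} [NormedAddCommGroup F] [NormedSpace ℝ F] (f : ℝ → ℝ → F) : ℝ → ℝ → F :=
  fun u w => deriv (fun t => f u t) w

/-- Iterated partial derivative `∂_u^i ∂_w^j f`. -/
def pd {F : Type*} [NormedAddCommGroup F] [NormedSpace ℝ F] (i j : ℕ) (f : ℝ → ℝ → F) :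
    ℝ → ℝ → F :=
  pdu^[i] (pdw^[j] f)

/-- The Euclidean inner product on `ℝ³ = ℝ × ℝ × ℝ`. -/
def dot3 (x y : ℝ × ℝ × ℝ) : ℝ := x.1 * y.1 + x.2.1 * y.2.1 + x.2.2 * y.2.2

/-- The cross product on `ℝ³ = ℝ × ℝ × ℝ`. -/
def cross3 (x y : ℝ × ℝ × ℝ) : ℝ × ℝ × ℝ :=
  (x.2.1 * y.2.2 - x.2.2 * y.2.1, x.2.2 * y.1 - x.1 * y.2.2, x.1 * y.2.1 - x.2.1 * y.1)

/-- The Euclidean norm on `ℝ³ = ℝ × ℝ × ℝ`. -/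
def norm3 (x : ℝ × ℝ × ℝ) : ℝ := Real.sqrt (dot3 x x)

/-- The surface parameterization `g(u,w) = (u, p(u,w), q(u,w))`. -/
def gmap (p q : ℝ → ℝ → ℝ) : ℝ → ℝ → ℝ × ℝ × ℝ := fun u w => (u, p u w, q u w)

/-- The height function on the surface parameterized by `g = (u, p, q)` along `v`. -/
def hgt (p q : ℝ → ℝ → ℝ) (v : ℝ × ℝ × ℝ) : ℝ → ℝ → ℝ :=
  fun u w => dot3 (gmap p q u w) v

/-- `g = (u, p(u,w), q(u,w))` is in normal form of order `N`. -/
def NormalFormN (N : ℕ) (p q : ℝ → ℝ → ℝ) (b : ℕ → ℝ) (a : ℕ → ℕ → ℝ) : Prop :=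
  ContDiff ℝ (⊤ : ℕ∞) (fun x : ℝ × ℝ => p x.1 x.2) ∧
  ContDiff ℝ (⊤ : ℕ∞) (fun x : ℝ × ℝ => q x.1 x.2) ∧
  p 0 0 = 0 ∧ q 0 0 = 0 ∧
  pd 1 0 p 0 0 = 0 ∧ pd 0 1 p 0 0 = 0 ∧ pd 1 0 q 0 0 = 0 ∧ pd 0 1 q 0 0 = 0 ∧
  pd 0 2 p 0 0 = 1 ∧
  (∀ i, 2 ≤ i → i ≤ N → pd i 0 p 0 0 = b i) ∧
  (∀ i j, 2 ≤ i + j → i + j ≤ N → 1 ≤ j → ¬(i = 0 ∧ j = 2) → pd i j p 0 0 = 0) ∧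
  (∀ i j, 2 ≤ i + j → i + j ≤ N → pd i j q 0 0 = a i j) ∧
  a 1 1 = 0 ∧ a 0 2 = 0

/-- `h` has an `A_k` singularity at the origin: up to a `C^∞` change of coordinates fixing
the origin, `h` equals `h(0,0) ± x² ± y^(k+1)`. -/
def HasAkSingAt (h : ℝ → ℝ → ℝ) (k : ℕ) : Prop :=
  ∃ (U V : Set (ℝ × ℝ)) (φ ψ : ℝ × ℝ → ℝ × ℝ) (ε₁ ε₂ : ℝ),
    IsOpen U ∧ IsOpen V ∧ ((0, 0) : ℝ × ℝ) ∈ U ∧ ((0, 0) : ℝ × ℝ) ∈ V ∧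
    ContDiffOn ℝ (⊤ : ℕ∞) φ U ∧ ContDiffOn ℝ (⊤ : ℕ∞) ψ V ∧
    Set.MapsTo φ U V ∧ Set.MapsTo ψ V U ∧
    (∀ x ∈ U, ψ (φ x) = x) ∧ (∀ y ∈ V, φ (ψ y) = y) ∧
    φ (0, 0) = (0, 0) ∧ (ε₁ = 1 ∨ ε₁ = -1) ∧ (ε₂ = 1 ∨ ε₂ = -1) ∧
    ∀ x ∈ U, h (φ x).1 (φ x).2 = h 0 0 + ε₁ * x.1 ^ 2 + ε₂ * x.2 ^ (k + 1)

/-- The parabolic-set function `Σ = ⟨g_uu, g_u × g_w⟩⟨g_ww, g_u × g_w⟩ − ⟨g_uw, g_u × g_w⟩²`. -/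
def SigmaFun (p q : ℝ → ℝ → ℝ) : ℝ → ℝ → ℝ := fun u w =>
  dot3 (pd 2 0 (gmap p q) u w) (cross3 (pd 1 0 (gmap p q) u w) (pd 0 1 (gmap p q) u w)) *
      dot3 (pd 0 2 (gmap p q) u w) (cross3 (pd 1 0 (gmap p q) u w) (pd 0 1 (gmap p q) u w)) -
    dot3 (pd 1 1 (gmap p q) u w) (cross3 (pd 1 0 (gmap p q) u w) (pd 0 1 (gmap p q) u w)) ^ 2

/-- The torsion of a space curve `L`. -/
def tor (L : ℝ → ℝ × ℝ × ℝ) : ℝ → ℝ := fun t =>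
  dot3 (cross3 (deriv L t) (deriv (deriv L) t)) (deriv (deriv (deriv L)) t) /
    norm3 (cross3 (deriv L t) (deriv (deriv L) t)) ^ 2

/-- The unit binormal vector of a space curve `L` at `t = 0`. -/
def binormal0 (L : ℝ → ℝ × ℝ × ℝ) : ℝ × ℝ × ℝ :=
  (norm3 (cross3 (deriv L 0) (deriv (deriv L) 0)))⁻¹ • cross3 (deriv L 0) (deriv (deriv L) 0)

/-- `f` is a parabolic Monge form with `∂_w² f(0,0) = k₂ ≠ 0`. -/
def MongeForm (f : ℝ → ℝ → ℝ) (k₂ : ℝ) : Prop :=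
  ContDiff ℝ (⊤ : ℕ∞) (fun x : ℝ × ℝ => f x.1 x.2) ∧ f 0 0 = 0 ∧
  pd 1 0 f 0 0 = 0 ∧ pd 0 1 f 0 0 = 0 ∧
  pd 2 0 f 0 0 = 0 ∧ pd 1 1 f 0 0 = 0 ∧ pd 0 2 f 0 0 = k₂ ∧ k₂ ≠ 0

/-- The parabolic-set function `P = f_uu f_ww − f_uw²` of a Monge form. -/
def Pfun (f : ℝ → ℝ → ℝ) : ℝ → ℝ → ℝ := fun u w =>
  pd 2 0 f u w * pd 0 2 f u w - pd 1 1 f u w ^ 2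

open Filter Topology

/-- Smoothness of a curried function of two real variables. -/
def Smooth₂ (h : ℝ → ℝ → ℝ) : Prop := ContDiff ℝ (⊤ : ℕ∞) (fun x : ℝ × ℝ => h x.1 x.2)

namespace Smooth₂

variable {h : ℝ → ℝ → ℝ}

lemma hasFDerivAt (hh : Smooth₂ h) (x : ℝ × ℝ) :
    HasFDerivAt (fun x : ℝ × ℝ => h x.1 x.2) (fderiv ℝ (fun x : ℝ × ℝ => h x.1 x.2) x) x :=
  (ContDiff.differentiable hh (by simp) x).hasFDerivAt

lemma pdu_eq (hh : Smooth₂ h) (u w : ℝ) :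
    pdu h u w = fderiv ℝ (fun x : ℝ × ℝ => h x.1 x.2) (u, w) (1, 0) :=
  ((hh.hasFDerivAt (u, w)).comp_hasDerivAt (f := fun t => (t, w)) u
    ((hasDerivAt_id u).prodMk (hasDerivAt_const u w))).deriv

lemma pdw_eq (hh : Smooth₂ h) (u w : ℝ) :
    pdw h u w = fderiv ℝ (fun x : ℝ × ℝ => h x.1 x.2) (u, w) (0, 1) :=
  ((hh.hasFDerivAt (u, w)).comp_hasDerivAt (f := fun t => (u, t)) w
    ((hasDerivAt_const w u).prodMk (hasDerivAt_id w))).deriv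

lemma contDiff_fderiv (hh : Smooth₂ h) :
    ContDiff ℝ (⊤ : ℕ∞) (fderiv ℝ (fun x : ℝ × ℝ => h x.1 x.2)) :=
  ContDiff.fderiv_right hh (by simp)

lemma smooth_pdu (hh : Smooth₂ h) : Smooth₂ (pdu h) := by
  simpa only [Smooth₂, hh.pdu_eq] using hh.contDiff_fderiv.clm_apply contDiff_const

lemma smooth_pdw (hh : Smooth₂ h) : Smooth₂ (pdw h) := by
  simpa only [Smooth₂, hh.pdw_eq] using hh.contDiff_fderiv.clm_apply contDiff_const

lemma pdu_pdw_comm (hh : Smooth₂ h) : pdu (pdw h) = pdw (pdu h) := by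
  funext u w
  have hd : DifferentiableAt ℝ (fderiv ℝ (fun x : ℝ × ℝ => h x.1 x.2)) (u, w) :=
    hh.contDiff_fderiv.differentiable (by simp) _
  have hsymm : IsSymmSndFDerivAt ℝ (fun x : ℝ × ℝ => h x.1 x.2) (u, w) :=
    (ContDiff.contDiffAt hh).isSymmSndFDerivAt (by simp; norm_cast)
  rw [hh.smooth_pdw.pdu_eq, hh.smooth_pdu.pdw_eq]
  simp only [hh.pdu_eq, hh.pdw_eq, Prod.mk.eta]
  rw [fderiv_clm_apply hd (differentiableAt_const _), fderiv_clm_apply hd (differentiableAt_const _)]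
  simpa using hsymm.eq (1, 0) (0, 1)

/-- Chain rule along a graph. -/
lemma hasDerivAt_comp_graph (hh : Smooth₂ h) {φ : ℝ → ℝ} {φ' t : ℝ} (hφ : HasDerivAt φ φ' t) :
    HasDerivAt (fun s => h s (φ s)) (pdu h t (φ t) + pdw h t (φ t) * φ') t := by
  have hc := (hh.hasFDerivAt (t, φ t)).comp_hasDerivAt (f := fun s => (s, φ s)) t
    ((hasDerivAt_id t).prodMk hφ)
  have hv : ((1, φ') : ℝ × ℝ) = (1, 0) + φ' • (0, 1) := by simp
  rw [hv, map_add, map_smul, ← hh.pdu_eq, ← hh.pdw_eq, smul_eq_mul, mul_comm] at hc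
  exact hc

lemma hasDerivAt_fst (hh : Smooth₂ h) (u w : ℝ) :
    HasDerivAt (fun t => h t w) (pdu h u w) u := by
  simpa using hh.hasDerivAt_comp_graph (hasDerivAt_const u w)

lemma hasDerivAt_snd (hh : Smooth₂ h) (u w : ℝ) :
    HasDerivAt (fun t => h u t) (pdw h u w) w := by
  rw [hh.pdw_eq]
  exact (hh.hasFDerivAt (u, w)).comp_hasDerivAt (f := fun t => (u, t)) w
    ((hasDerivAt_const w u).prodMk (hasDerivAt_id w))

lemma isInvertible_fderiv_inr (hh : Smooth₂ h) {u w : ℝ} (hw : pdw h u w ≠ 0) :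
    (fderiv ℝ (fun x : ℝ × ℝ => h x.1 x.2) (u, w) ∘L .inr ℝ ℝ ℝ).IsInvertible := by
  refine ⟨ContinuousLinearEquiv.unitsEquivAut ℝ (Units.mk0 _ hw), ?_⟩
  ext
  simp [hh.pdw_eq]

/-- A continuous solution of a smooth implicit equation with nonzero `w`-derivative is smooth. -/
lemma contDiffAt_of_eventually_eq_zero (hh : Smooth₂ h) {φ : ℝ → ℝ} {t : ℝ}
    (hφ : ContinuousAt φ t) (hz : ∀ᶠ s in 𝓝 t, h s (φ s) = 0)
    (hw : pdw h t (φ t) ≠ 0) : ContDiffAt ℝ (⊤ : ℕ∞) φ t := by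
  have hc : ContDiffAt ℝ (⊤ : ℕ∞) (fun x : ℝ × ℝ => h x.1 x.2) (t, φ t) := ContDiff.contDiffAt hh
  have hinv := hh.isInvertible_fderiv_inr hw
  have hlim : Tendsto (fun s => (s, φ s)) (𝓝 t) (𝓝 (t, φ t)) := continuousAt_id.prodMk hφ
  refine (hc.contDiffAt_implicitFunction (by simp) hinv).congr_of_eventuallyEq ?_
  filter_upwards [hz, hlim.eventually
    (hc.eventually_apply_eq_iff_implicitFunction (by simp) hinv)] with s hs hiff
  exact (hiff.1 (hs.trans hz.self_of_nhds.symm)).symm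

/-- The implicit function theorem for one smooth equation in two real unknowns. -/
lemma exists_implicit (hh : Smooth₂ h) (h0 : h 0 0 = 0) (hw : pdw h 0 0 ≠ 0) :
    ∃ φ : ℝ → ℝ, φ 0 = 0 ∧ (∀ᶠ t in 𝓝 0, ContDiffAt ℝ (⊤ : ℕ∞) φ t ∧ h t (φ t) = 0) ∧
      ∀ φ₂ : ℝ → ℝ, ContinuousAt φ₂ 0 → φ₂ 0 = 0 → (∀ᶠ t in 𝓝 0, h t (φ₂ t) = 0) →
        ∀ᶠ t in 𝓝 0, φ₂ t = φ t := by
  have hc : ContDiffAt ℝ (⊤ : ℕ∞) (fun x : ℝ × ℝ => h x.1 x.2) (0, 0) := ContDiff.contDiffAt hh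
  have hinv := hh.isInvertible_fderiv_inr hw
  have hn : ((⊤ : ℕ∞) : WithTop ℕ∞) ≠ 0 := by simp
  have hφ0 := hc.implicitFunction_apply_self hn hinv
  have hφz := hc.eventually_apply_implicitFunction hn hinv
  have hφi := hc.eventually_apply_eq_iff_implicitFunction hn hinv
  have hφd := hc.contDiffAt_implicitFunction hn hinv
  set φ := hc.implicitFunction hn hinv
  simp only [h0] at hφ0 hφz hφi hφd
  refine ⟨φ, hφ0, ?_, fun φ₂ hφ₂ hφ₂0 hφ₂z => ?_⟩
  · have hcont : ∀ᶠ t in 𝓝 0, ContinuousAt φ t :=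
      ((hφd.of_le (m := 1) (by norm_cast)).eventually (by simp)).mono
        fun t ht => ht.continuousAt
    have hne : ∀ᶠ t in 𝓝 0, pdw h t (φ t) ≠ 0 := by
      have hlim : ContinuousAt (fun t => pdw h t (φ t)) 0 :=
        (ContDiff.continuous hh.smooth_pdw).continuousAt.comp (f := fun t => (t, φ t))
          (continuousAt_id.prodMk hφd.continuousAt)
      exact hlim.eventually_ne (by simpa only [hφ0] using hw)
    filter_upwards [hφz.eventually_nhds, hcont, hne] with t hz hct hwt
    exact ⟨hh.contDiffAt_of_eventually_eq_zero hct hz hwt, hz.self_of_nhds⟩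
  · have hlim : Tendsto (fun t => (t, φ₂ t)) (𝓝 0) (𝓝 (0, 0)) := by
      have hpair : ContinuousAt (fun t => (t, φ₂ t)) 0 := continuousAt_id.prodMk hφ₂
      simpa only [hφ₂0] using hpair.tendsto
    filter_upwards [hφ₂z, hlim.eventually hφi] with t hz hiff
    exact (hiff.1 hz).symm

/-- The first two derivatives at a critical point of an implicitly defined function. -/
lemma deriv_implicit (hh : Smooth₂ h) {φ : ℝ → ℝ} (hφ0 : φ 0 = 0)
    (hφ : ∀ᶠ t in 𝓝 0, ContDiffAt ℝ (⊤ : ℕ∞) φ t ∧ h t (φ t) = 0)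
    (hu : pdu h 0 0 = 0) (hw : pdw h 0 0 ≠ 0) :
    deriv φ 0 = 0 ∧ deriv (deriv φ) 0 = -pdu (pdu h) 0 0 / pdw h 0 0 := by
  have hfirst : ∀ᶠ t in 𝓝 0, pdu h t (φ t) + pdw h t (φ t) * deriv φ t = 0 := by
    filter_upwards [hφ.eventually_nhds] with t ht
    have hd : HasDerivAt φ (deriv φ t) t :=
      (ht.self_of_nhds.1.differentiableAt (by simp)).hasDerivAt
    have hzero : (fun s => h s (φ s)) =ᶠ[𝓝 t] fun _ => 0 := ht.mono fun s hs => hs.2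
    exact (hh.hasDerivAt_comp_graph hd).unique ((hasDerivAt_const t 0).congr_of_eventuallyEq hzero)
  have hd0 : deriv φ 0 = 0 := by simpa [hφ0, hu, hw] using hfirst.self_of_nhds
  have hsm : ContDiffAt ℝ (⊤ : ℕ∞) φ 0 := hφ.self_of_nhds.1
  have h1 : HasDerivAt φ 0 0 := by
    simpa only [hd0] using (hsm.differentiableAt (by simp)).hasDerivAt
  have h2 : HasDerivAt (deriv φ) (deriv (deriv φ) 0) 0 := by
    have hfd : ContDiffAt ℝ 1 (fderiv ℝ φ) 0 := hsm.fderiv_right (by norm_cast)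
    exact ((hfd.differentiableAt (by simp)).clm_apply (differentiableAt_const 1)).hasDerivAt
  have hsecond := ((hh.smooth_pdu.hasDerivAt_comp_graph h1).add
    ((hh.smooth_pdw.hasDerivAt_comp_graph h1).mul h2)).unique
    ((hasDerivAt_const (0 : ℝ) (0 : ℝ)).congr_of_eventuallyEq hfirst)
  simp only [hφ0, hd0] at hsecond
  refine ⟨hd0, ?_⟩
  rw [eq_div_iff hw]
  linarith

end Smooth₂

/-- The `u`-derivative of `A B - C²`. -/
lemma pdu_mul_sub_sq {A B C : ℝ → ℝ → ℝ} (hA : Smooth₂ A) (hB : Smooth₂ B) (hC : Smooth₂ C)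
    (u w : ℝ) : pdu (fun u w => A u w * B u w - C u w ^ 2) u w =
      pdu A u w * B u w + A u w * pdu B u w - 2 * C u w * pdu C u w := by
  refine Eq.trans (((hA.hasDerivAt_fst u w).mul (hB.hasDerivAt_fst u w)).sub
    ((hC.hasDerivAt_fst u w).pow 2)).deriv ?_
  ring

/-- The `w`-derivative of `A B - C²`. -/
lemma pdw_mul_sub_sq {A B C : ℝ → ℝ → ℝ} (hA : Smooth₂ A) (hB : Smooth₂ B) (hC : Smooth₂ C)
    (u w : ℝ) : pdw (fun u w => A u w * B u w - C u w ^ 2) u w =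
      pdw A u w * B u w + A u w * pdw B u w - 2 * C u w * pdw C u w := by
  refine Eq.trans (((hA.hasDerivAt_snd u w).mul (hB.hasDerivAt_snd u w)).sub
    ((hC.hasDerivAt_snd u w).pow 2)).deriv ?_
  ring

/-- The second `u`-derivative of `A B - C²` where `A`, `pdu A` and `C` vanish. -/
lemma pdu_pdu_mul_sub_sq {A B C : ℝ → ℝ → ℝ} (hA : Smooth₂ A) (hB : Smooth₂ B) (hC : Smooth₂ C)
    {u w : ℝ} (hA0 : A u w = 0) (hA1 : pdu A u w = 0) (hC0 : C u w = 0) :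
    pdu (pdu (fun u w => A u w * B u w - C u w ^ 2)) u w =
      pdu (pdu A) u w * B u w - 2 * pdu C u w ^ 2 := by
  have hfirst : pdu (fun u w => A u w * B u w - C u w ^ 2) = fun u w =>
      pdu A u w * B u w + A u w * pdu B u w - 2 * C u w * pdu C u w := by
    funext u w
    exact pdu_mul_sub_sq hA hB hC u w
  rw [hfirst]
  refine Eq.trans ((((hA.smooth_pdu.hasDerivAt_fst u w).mul (hB.hasDerivAt_fst u w)).add
    ((hA.hasDerivAt_fst u w).mul (hB.smooth_pdu.hasDerivAt_fst u w))).sub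
    (((hC.hasDerivAt_fst u w).const_mul 2).mul (hC.smooth_pdu.hasDerivAt_fst u w))).deriv ?_
  simp only [hA0, hA1, hC0]
  ring

/-- for a parabolic Monge form with `a_{3,0} = 0` and `a_{2,1} ≠ 0`, the
parabolic set is locally the graph of a unique smooth function `ψ` with `ψ(0) = ψ'(0) = 0`
and `ψ''(0) = (2 a_{2,1}² − a_{4,0} k₂)/(a_{2,1} k₂)`. -/
theorem monge_parabolic_branch (f : ℝ → ℝ → ℝ) (k₂ : ℝ) (hM : MongeForm f k₂)
    (h30 : pd 3 0 f 0 0 = 0) (h21 : pd 2 1 f 0 0 ≠ 0) :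
    ∃ ε > (0 : ℝ), ∃ ψ : ℝ → ℝ, ContDiffOn ℝ (⊤ : ℕ∞) ψ (Set.Ioo (-ε) ε) ∧
      (∀ t : ℝ, |t| < ε → Pfun f t (ψ t) = 0) ∧ ψ 0 = 0 ∧ deriv ψ 0 = 0 ∧
      deriv (deriv ψ) 0 = (2 * pd 2 1 f 0 0 ^ 2 - pd 4 0 f 0 0 * k₂) / (pd 2 1 f 0 0 * k₂) ∧
      ∀ (ψ' : ℝ → ℝ) (δ : ℝ), 0 < δ → ContDiffOn ℝ (⊤ : ℕ∞) ψ' (Set.Ioo (-δ) δ) →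
        ψ' 0 = 0 → (∀ t : ℝ, |t| < δ → Pfun f t (ψ' t) = 0) →
        ∃ δ' > (0 : ℝ), ∀ t : ℝ, |t| < δ' → ψ' t = ψ t := by
  obtain ⟨hf, -, -, -, h20, h11, h02, hk⟩ := hM
  have hf : Smooth₂ f := hf
  have hA : Smooth₂ (pd 2 0 f) := hf.smooth_pdu.smooth_pdu
  have hB : Smooth₂ (pd 0 2 f) := hf.smooth_pdw.smooth_pdw
  have hC : Smooth₂ (pd 1 1 f) := hf.smooth_pdw.smooth_pdu
  have hP : Smooth₂ (Pfun f) := (ContDiff.mul hA hB).sub (ContDiff.pow hC 2)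
  have hAw : pdw (pd 2 0 f) = pd 2 1 f := by
    change pdw (pdu (pdu f)) = pdu (pdu (pdw f))
    rw [hf.pdu_pdw_comm, hf.smooth_pdu.pdu_pdw_comm]
  have hA1 : pdu (pd 2 0 f) 0 0 = 0 := h30
  have hP0 : Pfun f 0 0 = 0 := by simp [Pfun, h20, h11]
  have hPu : pdu (Pfun f) 0 0 = 0 := by
    refine (pdu_mul_sub_sq hA hB hC 0 0).trans ?_
    simp [h20, h11, hA1]
  have hPw : pdw (Pfun f) 0 0 = pd 2 1 f 0 0 * k₂ := by
    refine (pdw_mul_sub_sq hA hB hC 0 0).trans ?_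
    simp [h20, h11, h02, hAw]
  have hPuu : pdu (pdu (Pfun f)) 0 0 = pd 4 0 f 0 0 * k₂ - 2 * pd 2 1 f 0 0 ^ 2 := by
    rw [← h02]
    exact pdu_pdu_mul_sub_sq hA hB hC h20 hA1 h11
  have hPw0 : pdw (Pfun f) 0 0 ≠ 0 := hPw ▸ mul_ne_zero h21 hk
  obtain ⟨ψ, hψ0, hψ, huniq⟩ := hP.exists_implicit hP0 hPw0
  obtain ⟨hd1, hd2⟩ := hP.deriv_implicit hψ0 hψ hPu hPw0
  obtain ⟨ε, hε, hball⟩ := Metric.eventually_nhds_iff.1 hψ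
  simp only [Real.dist_eq, sub_zero] at hball
  refine ⟨ε, hε, ψ, fun t ht => (hball (abs_lt.2 ht)).1.contDiffWithinAt,
    fun t ht => (hball ht).2, hψ0, hd1, ?_, fun ψ' δ hδ hψ' hψ'0 hψ'z => ?_⟩
  · rw [hd2, hPuu, hPw, neg_sub]
  · have hcont : ContinuousAt ψ' 0 :=
      hψ'.continuousOn.continuousAt (Ioo_mem_nhds (neg_lt_zero.2 hδ) hδ)
    have hz : ∀ᶠ t in 𝓝 0, Pfun f t (ψ' t) = 0 :=
      Metric.eventually_nhds_iff.2 ⟨δ, hδ, fun t ht => hψ'z t (by simpa [Real.dist_eq] using ht)⟩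
    obtain ⟨δ', hδ', heq⟩ := Metric.eventually_nhds_iff.1 (huniq ψ' hcont hψ'0 hz)
    exact ⟨δ', hδ', fun t ht => heq (by simpa [Real.dist_eq] using ht)⟩
end
end

section
/- Let f be a parabolic Monge form with a_{3,0} = 0, a_{2,1} ≠ 0, and 2 a_{2,1}² − a_{4,0} k₂ ≠ 0. Let ψ : (−ε,ε) → ℝ be a C^∞ function with ψ(0) = ψ'(0) = 0 and P(t, ψ(t)) = 0 for all |t| < ε, and set L(t) = (t, ψ(t), f(t, ψ(t))). Then L'(0) × L''(0) ≠ 0, and the torsion of L satisfies τ(0) = 0 and τ'(0) = (8 a_{2,1}² − 3 a_{4,0} k₂)(3 a_{2,1}² − a_{4,0} k₂)/(a_{2,1}(2 a_{2,1}² − a_{4,0} k₂)). -/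
open Real Set

noncomputable section

section MixedPartials

variable {f : ℝ → ℝ → ℝ}

theorem hasDerivAt_fst_of_contDiff (hf : ContDiff ℝ (⊤ : ℕ∞) (fun x : ℝ × ℝ => f x.1 x.2))
    (u w : ℝ) :
    HasDerivAt (fun t => f t w) (fderiv ℝ (fun x : ℝ × ℝ => f x.1 x.2) (u, w) (1, 0)) u :=
  HasFDerivAt.comp_hasDerivAt (f := fun t => (t, w)) u
    ((hf.differentiable (by simp)) (u, w)).hasFDerivAt
    ((hasDerivAt_id' u).prodMk (hasDerivAt_const u w))

theorem hasDerivAt_snd_of_contDiff (hf : ContDiff ℝ (⊤ : ℕ∞) (fun x : ℝ × ℝ => f x.1 x.2))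
    (u w : ℝ) :
    HasDerivAt (fun t => f u t) (fderiv ℝ (fun x : ℝ × ℝ => f x.1 x.2) (u, w) (0, 1)) w :=
  HasFDerivAt.comp_hasDerivAt (f := fun t => (u, t)) w
    ((hf.differentiable (by simp)) (u, w)).hasFDerivAt
    ((hasDerivAt_const w u).prodMk (hasDerivAt_id' w))

theorem pdu_eq_fderiv (hf : ContDiff ℝ (⊤ : ℕ∞) (fun x : ℝ × ℝ => f x.1 x.2)) (u w : ℝ) :
    pdu f u w = fderiv ℝ (fun x : ℝ × ℝ => f x.1 x.2) (u, w) (1, 0) :=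
  (hasDerivAt_fst_of_contDiff hf u w).deriv

theorem pdw_eq_fderiv (hf : ContDiff ℝ (⊤ : ℕ∞) (fun x : ℝ × ℝ => f x.1 x.2)) (u w : ℝ) :
    pdw f u w = fderiv ℝ (fun x : ℝ × ℝ => f x.1 x.2) (u, w) (0, 1) :=
  (hasDerivAt_snd_of_contDiff hf u w).deriv

theorem contDiff_pdu (hf : ContDiff ℝ (⊤ : ℕ∞) (fun x : ℝ × ℝ => f x.1 x.2)) :
    ContDiff ℝ (⊤ : ℕ∞) (fun x : ℝ × ℝ => pdu f x.1 x.2) := by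
  simp_rw [pdu_eq_fderiv hf]
  exact (hf.fderiv_right (by simp)).clm_apply contDiff_const

theorem contDiff_pdw (hf : ContDiff ℝ (⊤ : ℕ∞) (fun x : ℝ × ℝ => f x.1 x.2)) :
    ContDiff ℝ (⊤ : ℕ∞) (fun x : ℝ × ℝ => pdw f x.1 x.2) := by
  simp_rw [pdw_eq_fderiv hf]
  exact (hf.fderiv_right (by simp)).clm_apply contDiff_const

theorem pdw_pdu_comm (hf : ContDiff ℝ (⊤ : ℕ∞) (fun x : ℝ × ℝ => f x.1 x.2)) :
    pdw (pdu f) = pdu (pdw f) := by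
  have hd : Differentiable ℝ (fderiv ℝ (fun x : ℝ × ℝ => f x.1 x.2)) :=
    (hf.fderiv_right (m := (⊤ : ℕ∞)) (by simp)).differentiable (by simp)
  funext u w
  have hs : IsSymmSndFDerivAt ℝ (fun x : ℝ × ℝ => f x.1 x.2) (u, w) :=
    hf.contDiffAt.isSymmSndFDerivAt (by
      rw [minSmoothness_of_isRCLikeNormedField]
      exact WithTop.coe_le_coe.2 (le_top : (2 : ℕ∞) ≤ ⊤))
  rw [pdw_eq_fderiv (contDiff_pdu hf), pdu_eq_fderiv (contDiff_pdw hf)]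
  simp_rw [pdu_eq_fderiv hf, pdw_eq_fderiv hf]
  rw [fderiv_clm_apply (hd _) (differentiableAt_const _),
    fderiv_clm_apply (hd _) (differentiableAt_const _)]
  simpa using hs (0, 1) (1, 0)

theorem contDiff_pd (hf : ContDiff ℝ (⊤ : ℕ∞) (fun x : ℝ × ℝ => f x.1 x.2)) (i j : ℕ) :
    ContDiff ℝ (⊤ : ℕ∞) (fun x : ℝ × ℝ => pd i j f x.1 x.2) := by
  induction i with
  | zero =>
    induction j with
    | zero => exact hf
    | succ j ih =>
      simp only [pd, Function.iterate_succ_apply', Function.iterate_zero, id] at ih ⊢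
      exact contDiff_pdw ih
  | succ i ih =>
    simp only [pd, Function.iterate_succ_apply'] at ih ⊢
    exact contDiff_pdu ih

theorem pdu_pd (f : ℝ → ℝ → ℝ) (i j : ℕ) : pdu (pd i j f) = pd (i + 1) j f :=
  (Function.iterate_succ_apply' pdu i _).symm

theorem pdw_pd (hf : ContDiff ℝ (⊤ : ℕ∞) (fun x : ℝ × ℝ => f x.1 x.2)) (i j : ℕ) :
    pdw (pd i j f) = pd i (j + 1) f := by
  induction i with
  | zero => exact (Function.iterate_succ_apply' pdw j _).symm
  | succ i ih => rw [← pdu_pd, pdw_pdu_comm (contDiff_pd hf i j), ih, pdu_pd]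

/-- The chain rule for a partial derivative of `f` restricted to the graph of `ψ`. -/
theorem hasDerivAt_pd_graph (hf : ContDiff ℝ (⊤ : ℕ∞) (fun x : ℝ × ℝ => f x.1 x.2)) (i j : ℕ)
    {ψ : ℝ → ℝ} {ψ' t : ℝ} (hψ : HasDerivAt ψ ψ' t) :
    HasDerivAt (fun s => pd i j f s (ψ s))
      (pd (i + 1) j f t (ψ t) + pd i (j + 1) f t (ψ t) * ψ') t := by
  have hg := contDiff_pd hf i j
  have h := ((hg.differentiable (by simp)) (t, ψ t)).hasFDerivAt.comp_hasDerivAt t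
    ((hasDerivAt_id t).prodMk hψ)
  refine h.congr_deriv ?_
  have hv : ((1, ψ') : ℝ × ℝ) = (1, 0) + ψ' • (0, 1) := by simp
  rw [← pdu_pd, ← pdw_pd hf, pdu_eq_fderiv hg, pdw_eq_fderiv hg, hv, map_add, map_smul,
    smul_eq_mul, mul_comm]

end MixedPartials

theorem norm3_sq (x : ℝ × ℝ × ℝ) : norm3 x ^ 2 = dot3 x x :=
  Real.sq_sqrt (by unfold dot3; nlinarith [mul_self_nonneg x.1, mul_self_nonneg x.2.1,
    mul_self_nonneg x.2.2])

/-- On an open set, a smooth function has its derivatives of all orders. -/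
theorem ContDiffOn.hasDerivAt_iterate_deriv {g : ℝ → ℝ} {s : Set ℝ} (hs : IsOpen s)
    (hg : ContDiffOn ℝ (⊤ : ℕ∞) g s) (n : ℕ) {t : ℝ} (ht : t ∈ s) :
    HasDerivAt (deriv^[n] g) (deriv^[n + 1] g t) t := by
  have h : ContDiffOn ℝ (⊤ : ℕ∞) (deriv^[n] g) s := by
    induction n with
    | zero => exact hg
    | succ n ih =>
      rw [Function.iterate_succ_apply']
      exact ih.deriv_of_isOpen hs (by simp)
  rw [Function.iterate_succ_apply']
  exact ((h.differentiableOn (by simp)).differentiableAt (hs.mem_nhds ht)).hasDerivAt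

/-- The first two derivatives and the torsion of the curve `fun t => (t, y t, z t)`. -/
theorem deriv_tor_graph_eqOn {s : Set ℝ} (hs : IsOpen s) {y y₁ y₂ y₃ z z₁ z₂ z₃ : ℝ → ℝ}
    (hy : ∀ t ∈ s, HasDerivAt y (y₁ t) t) (hy₁ : ∀ t ∈ s, HasDerivAt y₁ (y₂ t) t)
    (hy₂ : ∀ t ∈ s, HasDerivAt y₂ (y₃ t) t)
    (hz : ∀ t ∈ s, HasDerivAt z (z₁ t) t) (hz₁ : ∀ t ∈ s, HasDerivAt z₁ (z₂ t) t)
    (hz₂ : ∀ t ∈ s, HasDerivAt z₂ (z₃ t) t) :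
    Set.EqOn (deriv fun t => (t, y t, z t)) (fun t => (1, y₁ t, z₁ t)) s ∧
    Set.EqOn (deriv (deriv fun t => (t, y t, z t))) (fun t => (0, y₂ t, z₂ t)) s ∧
    Set.EqOn (tor fun t => (t, y t, z t)) (fun t => (y₂ t * z₃ t - z₂ t * y₃ t) /
      ((y₁ t * z₂ t - z₁ t * y₂ t) ^ 2 + z₂ t ^ 2 + y₂ t ^ 2)) s := by
  have h₁ : Set.EqOn (deriv fun t => (t, y t, z t)) (fun t => (1, y₁ t, z₁ t)) s :=
    fun t ht => ((hasDerivAt_id t).prodMk ((hy t ht).prodMk (hz t ht))).deriv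
  have h₂ : Set.EqOn (deriv (deriv fun t => (t, y t, z t))) (fun t => (0, y₂ t, z₂ t)) s := by
    intro t ht
    rw [(h₁.eventuallyEq_of_mem (hs.mem_nhds ht)).deriv_eq]
    exact ((hasDerivAt_const t 1).prodMk ((hy₁ t ht).prodMk (hz₁ t ht))).deriv
  refine ⟨h₁, h₂, fun t ht => ?_⟩
  have h₃ : deriv (deriv (deriv fun t => (t, y t, z t))) t = (0, y₃ t, z₃ t) := by
    rw [(h₂.eventuallyEq_of_mem (hs.mem_nhds ht)).deriv_eq]
    exact ((hasDerivAt_const t 0).prodMk ((hy₂ t ht).prodMk (hz₂ t ht))).deriv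
  simp only [tor, norm3_sq, h₁ ht, h₂ ht, h₃, cross3, dot3]
  congr 1 <;> ring


/-- for the parabolic branch `L(t) = (t, ψ(t), f(t, ψ(t)))` of a parabolic Monge
form with `a_{3,0} = 0`, `a_{2,1} ≠ 0` and `2 a_{2,1}² − a_{4,0} k₂ ≠ 0`, the curvature of `L`
at `0` is nonzero, `τ(0) = 0` and `τ'(0)` is as stated. -/
theorem monge_parabolic_branch_torsion (f : ℝ → ℝ → ℝ) (k₂ : ℝ) (hM : MongeForm f k₂)
    (h30 : pd 3 0 f 0 0 = 0) (h21 : pd 2 1 f 0 0 ≠ 0)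
    (hnd : 2 * pd 2 1 f 0 0 ^ 2 - pd 4 0 f 0 0 * k₂ ≠ 0)
    (ε : ℝ) (hε : 0 < ε) (ψ : ℝ → ℝ) (hψ : ContDiffOn ℝ (⊤ : ℕ∞) ψ (Set.Ioo (-ε) ε))
    (hψ0 : ψ 0 = 0) (hψ1 : deriv ψ 0 = 0)
    (hP : ∀ t : ℝ, |t| < ε → Pfun f t (ψ t) = 0) :
    let L : ℝ → ℝ × ℝ × ℝ := fun t => (t, ψ t, f t (ψ t))
    cross3 (deriv L 0) (deriv (deriv L) 0) ≠ 0 ∧ tor L 0 = 0 ∧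
    deriv (tor L) 0 =
      (8 * pd 2 1 f 0 0 ^ 2 - 3 * pd 4 0 f 0 0 * k₂) *
          (3 * pd 2 1 f 0 0 ^ 2 - pd 4 0 f 0 0 * k₂) /
        (pd 2 1 f 0 0 * (2 * pd 2 1 f 0 0 ^ 2 - pd 4 0 f 0 0 * k₂)) := by
  obtain ⟨hf, -, h10, h01, h20, h11, h02, hk⟩ := hM
  intro L
  set s : Set ℝ := Set.Ioo (-ε) ε
  have hs : IsOpen s := isOpen_Ioo
  have h0 : (0 : ℝ) ∈ s := ⟨by linarith, hε⟩
  obtain ⟨y₁, hy₁⟩ : ∃ g, g = deriv^[1] ψ := ⟨_, rfl⟩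
  obtain ⟨y₂, hy₂⟩ : ∃ g, g = deriv^[2] ψ := ⟨_, rfl⟩
  obtain ⟨y₃, hy₃⟩ : ∃ g, g = deriv^[3] ψ := ⟨_, rfl⟩
  obtain ⟨y₄, hy₄⟩ : ∃ g, g = deriv^[4] ψ := ⟨_, rfl⟩
  have d0 : ∀ t ∈ s, HasDerivAt ψ (y₁ t) t := fun t ht =>
    hy₁ ▸ hψ.hasDerivAt_iterate_deriv hs 0 ht
  have d1 : ∀ t ∈ s, HasDerivAt y₁ (y₂ t) t := fun t ht =>
    hy₁ ▸ hy₂ ▸ hψ.hasDerivAt_iterate_deriv hs 1 ht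
  have d2 : ∀ t ∈ s, HasDerivAt y₂ (y₃ t) t := fun t ht =>
    hy₂ ▸ hy₃ ▸ hψ.hasDerivAt_iterate_deriv hs 2 ht
  have d3 : ∀ t ∈ s, HasDerivAt y₃ (y₄ t) t := fun t ht =>
    hy₃ ▸ hy₄ ▸ hψ.hasDerivAt_iterate_deriv hs 3 ht
  have hy₁0 : y₁ 0 = 0 := by rw [hy₁]; exact hψ1
  have D : ∀ i j, ∀ t ∈ s, HasDerivAt (fun s => pd i j f s (ψ s))
      (pd (i + 1) j f t (ψ t) + pd i (j + 1) f t (ψ t) * y₁ t) t :=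
    fun i j t ht => hasDerivAt_pd_graph hf i j (d0 t ht)
  set z₁ : ℝ → ℝ := fun t => pd 1 0 f t (ψ t) + pd 0 1 f t (ψ t) * y₁ t with hz₁
  set z₂ : ℝ → ℝ := fun t => pd 2 0 f t (ψ t) + 2 * (pd 1 1 f t (ψ t) * y₁ t)
    + pd 0 2 f t (ψ t) * (y₁ t * y₁ t) + pd 0 1 f t (ψ t) * y₂ t with hz₂
  set z₃ : ℝ → ℝ := fun t => pd 3 0 f t (ψ t) + 3 * (pd 2 1 f t (ψ t) * y₁ t)
    + 3 * (pd 1 2 f t (ψ t) * (y₁ t * y₁ t)) + pd 0 3 f t (ψ t) * (y₁ t * (y₁ t * y₁ t))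
    + 3 * (pd 1 1 f t (ψ t) * y₂ t) + 3 * (pd 0 2 f t (ψ t) * (y₁ t * y₂ t))
    + pd 0 1 f t (ψ t) * y₃ t with hz₃
  have e0 : ∀ t ∈ s, HasDerivAt (fun t => f t (ψ t)) (z₁ t) t := D 0 0
  have e1 : ∀ t ∈ s, HasDerivAt z₁ (z₂ t) t := fun t ht =>
    ((D 1 0 t ht).add ((D 0 1 t ht).mul (d1 t ht))).congr_deriv (by simp only [hz₂]; ring)
  have e2 : ∀ t ∈ s, HasDerivAt z₂ (z₃ t) t := fun t ht =>
    ((((D 2 0 t ht).add (((D 1 1 t ht).mul (d1 t ht)).const_mul 2)).add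
      ((D 0 2 t ht).mul ((d1 t ht).mul (d1 t ht)))).add
      ((D 0 1 t ht).mul (d2 t ht))).congr_deriv (by simp only [hz₃, Pi.mul_apply]; ring)
  have e3 : HasDerivAt z₃ (pd 4 0 f 0 0 + 6 * pd 2 1 f 0 0 * y₂ 0 + 3 * k₂ * y₂ 0 ^ 2) 0 :=
    (((((((D 3 0 0 h0).add (((D 2 1 0 h0).mul (d1 0 h0)).const_mul 3)).add
      (((D 1 2 0 h0).mul ((d1 0 h0).mul (d1 0 h0))).const_mul 3)).add
      ((D 0 3 0 h0).mul ((d1 0 h0).mul ((d1 0 h0).mul (d1 0 h0))))).add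
      (((D 1 1 0 h0).mul (d2 0 h0)).const_mul 3)).add
      (((D 0 2 0 h0).mul ((d1 0 h0).mul (d2 0 h0))).const_mul 3)).add
      ((D 0 1 0 h0).mul (d3 0 h0))).congr_deriv (by
        simp only [Pi.mul_apply, hψ0, hy₁0, h01, h11, h02]; ring)
  have hz₁0 : z₁ 0 = 0 := by simp only [hz₁, hψ0, hy₁0, h10]; ring
  have hz₂0 : z₂ 0 = 0 := by simp only [hz₂, hψ0, hy₁0, h20, h01]; ring
  have hz₃0 : z₃ 0 = 0 := by simp only [hz₃, hψ0, hy₁0, h30, h11, h01]; ring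
  -- differentiating `P(t, ψ t) = 0` twice determines the second derivative of ψ at 0
  have hP0 : ∀ t ∈ s, pd 2 0 f t (ψ t) * pd 0 2 f t (ψ t)
      - pd 1 1 f t (ψ t) * pd 1 1 f t (ψ t) = 0 := fun t ht => by
    have := hP t (abs_lt.2 ht)
    rwa [Pfun, sq] at this
  have hP1 : ∀ t ∈ s, (pd 3 0 f t (ψ t) + pd 2 1 f t (ψ t) * y₁ t) * pd 0 2 f t (ψ t)
      + pd 2 0 f t (ψ t) * (pd 1 2 f t (ψ t) + pd 0 3 f t (ψ t) * y₁ t)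
      - 2 * (pd 1 1 f t (ψ t) * (pd 2 1 f t (ψ t) + pd 1 2 f t (ψ t) * y₁ t)) = 0 :=
    fun t ht => by
      have h := ((D 2 0 t ht).mul (D 0 2 t ht)).sub ((D 1 1 t ht).mul (D 1 1 t ht))
      have h' := h.unique ((hasDerivAt_const t (0 : ℝ)).congr_of_eventuallyEq
        (Filter.eventuallyEq_of_mem (hs.mem_nhds ht) hP0))
      linear_combination h'
  have hP2 : (pd 4 0 f 0 0 + pd 2 1 f 0 0 * y₂ 0) * k₂ = 2 * pd 2 1 f 0 0 ^ 2 := by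
    have h := ((((D 3 0 0 h0).add ((D 2 1 0 h0).mul (d1 0 h0))).mul (D 0 2 0 h0)).add
      ((D 2 0 0 h0).mul ((D 1 2 0 h0).add ((D 0 3 0 h0).mul (d1 0 h0))))).sub
      (((D 1 1 0 h0).mul ((D 2 1 0 h0).add ((D 1 2 0 h0).mul (d1 0 h0)))).const_mul 2)
    have h' := h.unique ((hasDerivAt_const (0 : ℝ) (0 : ℝ)).congr_of_eventuallyEq
      (Filter.eventuallyEq_of_mem (hs.mem_nhds h0) hP1))
    simp only [Pi.mul_apply, Pi.add_apply, hψ0, hy₁0, h20, h11, h02, h30] at h'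
    linear_combination h'
  have hy₂0 : y₂ 0 ≠ 0 := fun h => hnd (by rw [h] at hP2; linear_combination -hP2)
  obtain ⟨hL₁, hL₂, htor⟩ := deriv_tor_graph_eqOn hs d0 d1 d2 e0 e1 e2
  refine ⟨?_, ?_, ?_⟩
  · rw [hL₁ h0, hL₂ h0]
    simp [cross3, hy₂0]
  · simpa [hz₂0, hz₃0] using htor h0
  · have hQ : (y₁ 0 * z₂ 0 - z₁ 0 * y₂ 0) ^ 2 + z₂ 0 ^ 2 + y₂ 0 ^ 2 ≠ 0 := by
      simpa [hy₁0, hz₁0, hz₂0] using hy₂0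
    have h := (((d2 0 h0).mul e3).sub ((e2 0 h0).mul (d3 0 h0))).div
      ((((((d1 0 h0).mul (e2 0 h0)).sub ((e1 0 h0).mul (d2 0 h0))).pow 2).add
        ((e2 0 h0).pow 2)).add ((d2 0 h0).pow 2)) hQ
    rw [(htor.eventuallyEq_of_mem (hs.mem_nhds h0)).deriv_eq]
    refine h.deriv.trans ?_
    simp only [Pi.mul_apply, Pi.add_apply, Pi.sub_apply, Pi.pow_apply, hy₁0, hz₁0, hz₂0, hz₃0]
    have hc : y₂ 0 = (2 * pd 2 1 f 0 0 ^ 2 - pd 4 0 f 0 0 * k₂) / (pd 2 1 f 0 0 * k₂) := by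
      field_simp
      linear_combination hP2
    have hsimp : y₂ 0 * (pd 4 0 f 0 0 + 6 * pd 2 1 f 0 0 * y₂ 0 + 3 * k₂ * y₂ 0 ^ 2)
        / y₂ 0 ^ 2 = (8 * pd 2 1 f 0 0 ^ 2 - 3 * pd 4 0 f 0 0 * k₂) *
          (3 * pd 2 1 f 0 0 ^ 2 - pd 4 0 f 0 0 * k₂) /
        (pd 2 1 f 0 0 * (2 * pd 2 1 f 0 0 ^ 2 - pd 4 0 f 0 0 * k₂)) := by
      rw [hc]
      field_simp
      ring
    rw [← hsimp]
    field_simp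
    ring
end
end
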